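/- For integers $0 \le j, k \le \ell$, the Hahn polynomial values $U_{jk} = {}_3F_2(-k, -j, k+1; 1, -\ell; 1)$ satisfy the orthogonality relation $\sum_{r=0}^{\ell} U_{rj} U_{rk} = \delta_{jk} \frac{(\ell+j+1)!\,(\ell-j)!}{(2j+1)\,\ell!\,\ell!}$. -/

import Mathlib

/-- Pochhammer symbol (rising factorial) over ℂ. -/
noncomputable def poch (x : ℂ) (m : ℕ) : ℂ := ∏ i ∈ Finset.range m, (x + i)

/-- Hahn polynomial value `U_{j k} = ₃F₂(-k, -j, k+1; 1, -ℓ; 1)` (terminating sum). -/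
noncomputable def hahnU (ℓ j k : ℕ) : ℂ :=
  ∑ m ∈ Finset.range (k + 1),
    (poch (-(k : ℂ)) m * poch (-(j : ℂ)) m * poch ((k : ℂ) + 1) m) /
      (poch 1 m * poch (-(ℓ : ℂ)) m * (Nat.factorial m : ℂ))

open Polynomial in
lemma alt_sum_poly (P : ℂ[X]) (k : ℕ) (hP : P.natDegree < k) :
    ∑ m ∈ Finset.range (k + 1), (-1 : ℂ) ^ m * (k.choose m : ℂ) * P.eval (m : ℂ) = 0 := by
  have h := congrFun (Polynomial.fwdDiff_iter_eq_zero_of_degree_lt hP) 0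
  rw [fwdDiff_iter_eq_sum_shift] at h
  have h2 : ∑ m ∈ Finset.range (k + 1), (-1 : ℂ) ^ m * (k.choose m : ℂ) * P.eval (m : ℂ)
      = (-1) ^ k * ∑ m ∈ Finset.range (k + 1),
        ((-1 : ℤ) ^ (k - m) * (k.choose m : ℤ)) • P.eval ((0 : ℂ) + m • (1 : ℂ)) := by
    rw [Finset.mul_sum]
    refine Finset.sum_congr rfl fun m hm => ?_
    have hm' : m ≤ k := Nat.lt_succ_iff.mp (Finset.mem_range.mp hm)
    obtain ⟨d, rfl⟩ := Nat.exists_eq_add_of_le hm'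
    have h1 : ((-1 : ℂ) ^ d) * (-1) ^ d = 1 := by
      rw [← mul_pow]; norm_num
    simp only [zsmul_eq_mul, Nat.add_sub_cancel_left]
    push_cast
    simp only [nsmul_eq_mul, mul_one, zero_add]
    rw [pow_add]
    linear_combination (-(-1 : ℂ) ^ m * ((m + d).choose m : ℂ) * eval (m : ℂ) P) * h1
  rw [h2]
  simpa using h

lemma alt_sum_succ (k : ℕ) (f : ℕ → ℂ) :
    ∑ m ∈ Finset.range (k + 2), (-1 : ℂ) ^ m * ((k + 1).choose m : ℂ) * f m =
      ∑ m ∈ Finset.range (k + 1), (-1 : ℂ) ^ m * (k.choose m : ℂ) * f m -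
      ∑ m ∈ Finset.range (k + 1), (-1 : ℂ) ^ m * (k.choose m : ℂ) * f (m + 1) := by
  have h : ∑ m ∈ Finset.range (k + 1), (-1 : ℂ) ^ m * (k.choose m : ℂ) * f m =
      ∑ m ∈ Finset.range (k + 2), (-1 : ℂ) ^ m * (k.choose m : ℂ) * f m := by
    rw [Finset.sum_range_succ _ (k + 1)]; simp
  rw [h, Finset.sum_range_succ', Finset.sum_range_succ' _ (k + 1), add_sub_right_comm,
    ← Finset.sum_sub_distrib]
  simp only [Nat.choose_succ_succ, Nat.choose_zero_right]
  congr 1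
  refine Finset.sum_congr rfl fun m _ => ?_
  push_cast
  ring

lemma beta_sum (k : ℕ) : ∀ a : ℕ,
    ∑ m ∈ Finset.range (k + 1), (-1 : ℂ) ^ m * (k.choose m : ℂ) * (1 / ((m : ℂ) + a + 1)) =
      (k.factorial : ℂ) * a.factorial / ((k + a + 1).factorial : ℂ) := by
  induction k with
  | zero =>
    intro a
    have h1 : (a : ℂ) + 1 ≠ 0 := by exact_mod_cast Nat.succ_ne_zero a
    have h2 : (a.factorial : ℂ) ≠ 0 := by exact_mod_cast a.factorial_ne_zero
    simp [Nat.factorial_succ]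
    field_simp
  | succ k ih =>
    intro a
    rw [alt_sum_succ, ih a]
    have h := ih (a + 1)
    have e : ∀ m : ℕ, ((m + 1 : ℕ) : ℂ) + a + 1 = (m : ℂ) + ((a + 1 : ℕ) : ℂ) + 1 := by
      intro m; push_cast; ring
    simp only [e]
    rw [h]
    have e1 : k + (a + 1) + 1 = (k + a + 1) + 1 := by ring
    have e2 : k + 1 + a + 1 = (k + a + 1) + 1 := by ring
    rw [e1, e2, Nat.factorial_succ (k + a + 1), Nat.factorial_succ k, Nat.factorial_succ a]
    have h2 : ((k + a + 1).factorial : ℂ) ≠ 0 := by exact_mod_cast Nat.factorial_ne_zero _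
    have h3 : ((k : ℂ) + a + 1 + 1) ≠ 0 := by exact_mod_cast Nat.succ_ne_zero (k + a + 1)
    push_cast
    field_simp
    ring

lemma conv_choose (m : ℕ) : ∀ (l n : ℕ),
    ∑ r ∈ Finset.range (l + 1), r.choose m * (l - r).choose n = (l + 1).choose (m + n + 1) := by
  intro l
  induction l with
  | zero =>
    intro n
    rcases m with _ | m <;> rcases n with _ | n <;> simp [Nat.choose_eq_zero_of_lt]
  | succ l ih =>
    intro n
    rcases n with _ | n
    · have h := ih 0
      simp only [Nat.choose_zero_right, mul_one] at h ⊢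
      rw [Finset.sum_range_succ, h, Nat.choose_succ_succ (l + 1)]
      simp [add_comm]
    · rw [Finset.sum_range_succ]
      have h : ∀ r ∈ Finset.range (l + 1), r.choose m * (l + 1 - r).choose (n + 1) =
          r.choose m * (l - r).choose n + r.choose m * (l - r).choose (n + 1) := by
        intro r hr
        have hr' : r ≤ l := Nat.lt_succ_iff.mp (Finset.mem_range.mp hr)
        rw [Nat.succ_sub hr', Nat.choose_succ_succ]; ring
      rw [Finset.sum_congr rfl h, Finset.sum_add_distrib, ih, ih, ← add_assoc m n 1,
        Nat.choose_succ_succ (l + 1)]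
      simp

lemma choose_expand (s : ℕ) : ∀ r m : ℕ,
    ∑ n ∈ Finset.range (m + 1), (-1 : ℂ) ^ n * ((r + s - n).choose (m - n) : ℂ) * (s.choose n : ℂ)
      = (r.choose m : ℂ) := by
  induction s with
  | zero =>
    intro r m
    rw [Finset.sum_range_succ']
    simp
  | succ s ih =>
    intro r m
    rcases m with _ | m
    · simp
    · have h1 := ih (r + 1) (m + 1)
      have h2 := ih r m
      rw [Finset.sum_range_succ'] at h1 ⊢
      have e : ∀ n, r + (s + 1) - (n + 1) = r + s - n := by intro n; omega
      have e' : ∀ n, r + 1 + s - (n + 1) = r + s - n := by intro n; omega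
      have e3 : r + 1 + s = r + (s + 1) := by ring
      simp only [e', Nat.add_sub_add_right] at h1
      simp only [e, Nat.add_sub_add_right]
      rw [e3] at h1
      have h3 : ((r + 1).choose (m + 1) : ℂ) = r.choose m + r.choose (m + 1) := by
        rw [Nat.choose_succ_succ]; push_cast; ring
      have h4 : ∑ n ∈ Finset.range (m + 1),
          (-1 : ℂ) ^ (n + 1) * ((r + s - n).choose (m - n) : ℂ) * ((s + 1).choose (n + 1) : ℂ) =
          ∑ n ∈ Finset.range (m + 1),
          (-1 : ℂ) ^ (n + 1) * ((r + s - n).choose (m - n) : ℂ) * (s.choose (n + 1) : ℂ) -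
          ∑ n ∈ Finset.range (m + 1),
          (-1 : ℂ) ^ n * ((r + s - n).choose (m - n) : ℂ) * (s.choose n : ℂ) := by
        rw [← Finset.sum_sub_distrib]
        refine Finset.sum_congr rfl fun n _ => ?_
        rw [Nat.choose_succ_succ]; push_cast; ring
      rw [h4, h2]
      simp only [Nat.choose_zero_right] at h1 ⊢
      linear_combination h1 + h3

lemma poch_neg (a m : ℕ) :
    poch (-(a : ℂ)) m = (-1) ^ m * ((m.factorial : ℂ) * (a.choose m : ℂ)) := by
  have h : ((m.factorial : ℂ) * (a.choose m : ℂ)) = (a.descFactorial m : ℂ) := by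
    rw [Nat.descFactorial_eq_factorial_mul_choose]; push_cast; ring
  rw [h, ← descPochhammer_eval_eq_descFactorial, descPochhammer_eval_eq_prod_range, poch]
  have : (-1 : ℂ) ^ m = ∏ i ∈ Finset.range m, (-1 : ℂ) := by simp
  rw [this, ← Finset.prod_mul_distrib]
  refine Finset.prod_congr rfl fun i _ => ?_
  ring

lemma poch_succ (a m : ℕ) :
    poch ((a : ℂ) + 1) m = (m.factorial : ℂ) * ((a + m).choose m : ℂ) := by
  have h : ((m.factorial : ℂ) * ((a + m).choose m : ℂ)) = ((a + 1).ascFactorial m : ℂ) := by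
    rw [Nat.ascFactorial_eq_factorial_mul_choose]; push_cast; ring
  rw [h, poch]
  induction m with
  | zero => simp
  | succ m ih =>
    rw [Finset.prod_range_succ, ih ?_, Nat.ascFactorial_succ]
    · push_cast; ring
    · rw [Nat.ascFactorial_eq_factorial_mul_choose]; push_cast; ring

lemma poch_one (m : ℕ) : poch 1 m = (m.factorial : ℂ) := by
  have := poch_succ 0 m
  simpa using this

lemma hahnU_eq (l r k : ℕ) : hahnU l r k = ∑ m ∈ Finset.range (k + 1),
    (-1 : ℂ) ^ m * (k.choose m : ℂ) * ((k + m).choose m : ℂ) * (r.choose m : ℂ)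
      / (l.choose m : ℂ) := by
  unfold hahnU
  refine Finset.sum_congr rfl fun m _ => ?_
  rw [poch_neg, poch_neg, poch_neg, poch_succ, poch_one]
  have h2 : (m.factorial : ℂ) ≠ 0 := by exact_mod_cast m.factorial_ne_zero
  have h3 : ((-1 : ℂ) ^ m) ≠ 0 := by simp
  by_cases h : (l.choose m : ℂ) = 0
  · simp [h]
  · field_simp

lemma term_eq (l m n k : ℕ) (hm : m ≤ l) :
    ((k + m).choose m : ℂ) * ((l + 1).choose (m + n + 1) : ℂ) / (l.choose m : ℂ) =
      ((l : ℂ) + 1) * ((k + m).factorial : ℂ) / ((k.factorial : ℂ) * ((m + n + 1).factorial : ℂ))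
        * ((l - m).descFactorial n : ℂ) := by
  have h1 : ((l.choose m : ℕ) : ℂ) ≠ 0 := by
    exact_mod_cast (Nat.choose_pos hm).ne'
  have h2 : (k.factorial : ℂ) ≠ 0 := by exact_mod_cast k.factorial_ne_zero
  have h3 : ((m + n + 1).factorial : ℂ) ≠ 0 := by exact_mod_cast Nat.factorial_ne_zero _
  have h4 : (m.factorial : ℂ) ≠ 0 := by exact_mod_cast m.factorial_ne_zero
  have a1 : (m + n + 1).factorial * (l + 1).choose (m + n + 1) =
      (l + 1) * ((l - m).descFactorial n * (m.factorial * l.choose m)) := by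
    rw [← Nat.descFactorial_eq_factorial_mul_choose, ← Nat.descFactorial_eq_factorial_mul_choose,
      Nat.succ_descFactorial_succ]
    have := Nat.descFactorial_mul_descFactorial (n := l) (Nat.le_add_right m n)
    rw [Nat.add_sub_cancel_left] at this
    rw [this]
  have a2 : (k + m).choose m * k.factorial * m.factorial = (k + m).factorial := by
    have := Nat.choose_mul_factorial_mul_factorial (Nat.le_add_left m k)
    rw [Nat.add_sub_cancel] at this
    rw [← this]; ring
  have a1' : ((m + n + 1).factorial : ℂ) * ((l + 1).choose (m + n + 1) : ℂ) =
      ((l : ℂ) + 1) * (((l - m).descFactorial n : ℂ) * (m.factorial * (l.choose m : ℂ))) := by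
    exact_mod_cast a1
  have a2' : ((k + m).choose m : ℂ) * k.factorial * m.factorial = ((k + m).factorial : ℂ) := by
    exact_mod_cast a2
  rw [← a2', div_mul_eq_mul_div, div_eq_div_iff h1 (mul_ne_zero h2 h3)]
  linear_combination ((k + m).choose m : ℂ) * (k.factorial : ℂ) * a1'

lemma S_eq (l k n : ℕ) (hk : k ≤ l) :
    ∑ r ∈ Finset.range (l + 1), ((l - r).choose n : ℂ) * hahnU l r k =
      ∑ m ∈ Finset.range (k + 1), (-1 : ℂ) ^ m * (k.choose m : ℂ) *
        (((l : ℂ) + 1) * ((k + m).factorial : ℂ) /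
          ((k.factorial : ℂ) * ((m + n + 1).factorial : ℂ)) * ((l - m).descFactorial n : ℂ)) := by
  simp only [hahnU_eq, Finset.mul_sum]
  rw [Finset.sum_comm]
  refine Finset.sum_congr rfl fun m hm => ?_
  have hm' : m ≤ k := Nat.lt_succ_iff.mp (Finset.mem_range.mp hm)
  rw [← term_eq l m n k (hm'.trans hk), ← conv_choose]
  push_cast
  rw [Finset.mul_sum, Finset.sum_div, Finset.mul_sum]
  refine Finset.sum_congr rfl fun r _ => ?_
  ring

open Polynomial in
noncomputable def fallP (l n : ℕ) : ℂ[X] := (descPochhammer ℂ n).comp (C (l : ℂ) - X)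

open Polynomial in
lemma fallP_natDegree (l n : ℕ) : (fallP l n).natDegree ≤ n := by
  unfold fallP
  refine natDegree_comp_le.trans ?_
  rw [descPochhammer_natDegree]
  have : (C (l : ℂ) - X).natDegree ≤ 1 := by compute_degree
  nlinarith

open Polynomial in
lemma fallP_eval (l n m : ℕ) (h : m ≤ l) :
    (fallP l n).eval (m : ℂ) = ((l - m).descFactorial n : ℂ) := by
  rw [← descPochhammer_eval_eq_descFactorial]
  simp [fallP, Nat.cast_sub h]

open Polynomial in
lemma S_lt (l k n : ℕ) (hk : k ≤ l) (hn : n < k) :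
    ∑ r ∈ Finset.range (l + 1), ((l - r).choose n : ℂ) * hahnU l r k = 0 := by
  rw [S_eq l k n hk]
  obtain ⟨d, rfl⟩ := Nat.exists_eq_add_of_lt hn
  set Q : ℂ[X] := (ascPochhammer ℂ d).comp (X + C ((n : ℂ) + 2)) with hQ
  have hQd : Q.natDegree ≤ d := by
    rw [hQ]
    refine natDegree_comp_le.trans ?_
    rw [ascPochhammer_natDegree]
    have : (X + C ((n : ℂ) + 2)).natDegree ≤ 1 := by compute_degree
    nlinarith
  have hQe : ∀ m : ℕ, ((n + d + 1 + m).factorial : ℂ)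
      = ((m + n + 1).factorial : ℂ) * Q.eval (m : ℂ) := by
    intro m
    have h1 := Nat.factorial_mul_ascFactorial (m + n + 1) d
    have h2 : Q.eval (m : ℂ) = ((m + n + 1 + 1).ascFactorial d : ℂ) := by
      rw [← ascPochhammer_nat_eq_ascFactorial, ascPochhammer_eval_cast, hQ]
      simp only [eval_comp, eval_add, eval_X, eval_C]
      congr 1
      push_cast; ring
    rw [h2]
    have e : n + d + 1 + m = m + n + 1 + d := by ring
    rw [e, ← h1]; push_cast; ring
  have key := alt_sum_poly (C (((l : ℂ) + 1) / ((n + d + 1).factorial : ℂ)) * (Q * fallP l n))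
    (n + d + 1) (by
      have h1 := natDegree_C_mul_le (((l : ℂ) + 1) / ((n + d + 1).factorial : ℂ)) (Q * fallP l n)
      have h2 := natDegree_mul_le (p := Q) (q := fallP l n)
      have h3 := fallP_natDegree l n
      omega)
  rw [← key]
  refine Finset.sum_congr rfl fun m hm => ?_
  have hm' : m ≤ n + d + 1 := Nat.lt_succ_iff.mp (Finset.mem_range.mp hm)
  rw [eval_mul, eval_mul, eval_C, fallP_eval l n m (hm'.trans hk), hQe m]
  have h3 : ((m + n + 1).factorial : ℂ) ≠ 0 := by exact_mod_cast Nat.factorial_ne_zero _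
  have h4 : ((n + d + 1).factorial : ℂ) ≠ 0 := by exact_mod_cast Nat.factorial_ne_zero _
  field_simp

open Polynomial in
lemma S_self (l k : ℕ) (hk : k ≤ l) :
    ∑ r ∈ Finset.range (l + 1), ((l - r).choose k : ℂ) * hahnU l r k =
      ((l + k + 1).factorial : ℂ) * (k.factorial : ℂ) /
        ((l.factorial : ℂ) * ((2 * k + 1).factorial : ℂ)) := by
  rw [S_eq l k k hk]
  set P := fallP l k with hP
  set a : ℂ := -((k : ℂ) + 1) with ha
  have hPa : P.eval a = ((l + k + 1).factorial : ℂ) / ((l + 1).factorial : ℂ) := by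
    have h0 : ((l + 1).factorial : ℂ) ≠ 0 := by exact_mod_cast Nat.factorial_ne_zero _
    have h1 : P.eval a = (((l + k + 1).descFactorial k : ℕ) : ℂ) := by
      rw [← descPochhammer_eval_eq_descFactorial, hP, ha]
      simp only [fallP, eval_comp, eval_sub, eval_X, eval_C]
      congr 1
      push_cast; ring
    have h2 := Nat.factorial_mul_descFactorial (n := l + k + 1) (k := k) (by omega)
    have e : l + k + 1 - k = l + 1 := by omega
    rw [e] at h2
    rw [h1, ← h2]; push_cast; field_simp
  have hdvd := mul_divByMonic_eq_iff_isRoot (p := P - C (P.eval a)) (a := a)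
  have hroot : (P - C (P.eval a)).IsRoot a := by simp [IsRoot]
  have hfac := hdvd.mpr hroot
  set Q := (P - C (P.eval a)) /ₘ (X - C a) with hQ
  have hQsum : ∑ m ∈ Finset.range (k + 1), (-1 : ℂ) ^ m * (k.choose m : ℂ) * Q.eval (m : ℂ) = 0 := by
    rcases Nat.eq_zero_or_pos k with h0 | hpos
    · have : Q = 0 := by
        have hP1 : P = 1 := by rw [hP, h0]; simp [fallP]
        rw [hQ, hP1]; simp
      simp [this]
    · apply alt_sum_poly
      rw [hQ, natDegree_divByMonic _ (monic_X_sub_C a), natDegree_X_sub_C]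
      have h1 := fallP_natDegree l k
      have h2 : (P - C (P.eval a)).natDegree ≤ k := by
        rw [natDegree_sub_C]; exact h1
      omega
  have hb := beta_sum k k
  have hterm : ∀ m ∈ Finset.range (k + 1), (-1 : ℂ) ^ m * (k.choose m : ℂ) *
        (((l : ℂ) + 1) * ((k + m).factorial : ℂ) /
          ((k.factorial : ℂ) * ((m + k + 1).factorial : ℂ)) * ((l - m).descFactorial k : ℂ)) =
      ((l : ℂ) + 1) / (k.factorial : ℂ) * ((-1 : ℂ) ^ m * (k.choose m : ℂ) * Q.eval (m : ℂ)) +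
      ((l : ℂ) + 1) / (k.factorial : ℂ) * P.eval a *
        ((-1 : ℂ) ^ m * (k.choose m : ℂ) * (1 / ((m : ℂ) + k + 1))) := by
    intro m hm
    have hm' : m ≤ k := Nat.lt_succ_iff.mp (Finset.mem_range.mp hm)
    rw [← fallP_eval l k m (hm'.trans hk), ← hP]
    have h1 : P.eval (m : ℂ) = ((m : ℂ) + k + 1) * Q.eval (m : ℂ) + P.eval a := by
      have := congrArg (eval (m : ℂ)) hfac
      simp only [eval_mul, eval_sub, eval_X, eval_C] at this
      rw [ha] at this ⊢
      linear_combination -this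
    rw [h1, Nat.factorial_succ (m + k), add_comm k m]
    have h2 : ((m + k).factorial : ℂ) ≠ 0 := by exact_mod_cast Nat.factorial_ne_zero _
    have h3 : (k.factorial : ℂ) ≠ 0 := by exact_mod_cast Nat.factorial_ne_zero _
    have h4 : ((m : ℂ) + k + 1) ≠ 0 := by exact_mod_cast Nat.succ_ne_zero (m + k)
    push_cast
    field_simp
  rw [Finset.sum_congr rfl hterm, Finset.sum_add_distrib, ← Finset.mul_sum, ← Finset.mul_sum,
    hQsum, hb, hPa, Nat.factorial_succ l, two_mul]
  have h2 : (l.factorial : ℂ) ≠ 0 := by exact_mod_cast Nat.factorial_ne_zero _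
  have h3 : (k.factorial : ℂ) ≠ 0 := by exact_mod_cast Nat.factorial_ne_zero _
  have h4 : ((l : ℂ) + 1) ≠ 0 := by exact_mod_cast Nat.succ_ne_zero l
  have h5 : ((k + k + 1).factorial : ℂ) ≠ 0 := by exact_mod_cast Nat.factorial_ne_zero _
  push_cast
  field_simp
  ring

lemma T_eq (l k m : ℕ) :
    ∑ r ∈ Finset.range (l + 1), (r.choose m : ℂ) * hahnU l r k =
      ∑ n ∈ Finset.range (m + 1), (-1 : ℂ) ^ n * ((l - n).choose (m - n) : ℂ) *
        ∑ r ∈ Finset.range (l + 1), ((l - r).choose n : ℂ) * hahnU l r k := by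
  simp only [Finset.mul_sum]
  rw [Finset.sum_comm]
  refine Finset.sum_congr rfl fun r hr => ?_
  have hr' : r ≤ l := Nat.lt_succ_iff.mp (Finset.mem_range.mp hr)
  rw [← choose_expand (l - r) r m, Nat.add_sub_cancel' hr', Finset.sum_mul]
  refine Finset.sum_congr rfl fun n _ => ?_
  ring

lemma T_lt (l k m : ℕ) (hk : k ≤ l) (hm : m < k) :
    ∑ r ∈ Finset.range (l + 1), (r.choose m : ℂ) * hahnU l r k = 0 := by
  rw [T_eq]
  refine Finset.sum_eq_zero fun n hn => ?_
  rw [S_lt l k n hk (by have := Finset.mem_range.mp hn; omega), mul_zero]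

lemma T_self (l k : ℕ) (hk : k ≤ l) :
    ∑ r ∈ Finset.range (l + 1), (r.choose k : ℂ) * hahnU l r k =
      (-1) ^ k * (((l + k + 1).factorial : ℂ) * (k.factorial : ℂ) /
        ((l.factorial : ℂ) * ((2 * k + 1).factorial : ℂ))) := by
  rw [T_eq, Finset.sum_range_succ, S_self l k hk, Finset.sum_eq_zero]
  · simp
  · intro n hn
    rw [S_lt l k n hk (Finset.mem_range.mp hn), mul_zero]

lemma prod_eq (l j k : ℕ) :
    ∑ r ∈ Finset.range (l + 1), hahnU l r j * hahnU l r k =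
      ∑ m ∈ Finset.range (j + 1),
        (-1 : ℂ) ^ m * (j.choose m : ℂ) * ((j + m).choose m : ℂ) / (l.choose m : ℂ) *
        ∑ r ∈ Finset.range (l + 1), (r.choose m : ℂ) * hahnU l r k := by
  simp only [Finset.mul_sum]
  rw [Finset.sum_comm]
  refine Finset.sum_congr rfl fun r hr => ?_
  rw [hahnU_eq l r j, Finset.sum_mul]
  refine Finset.sum_congr rfl fun n _ => ?_
  ring

lemma orth_lt (l j k : ℕ) (hk : k ≤ l) (h : j < k) :
    ∑ r ∈ Finset.range (l + 1), hahnU l r j * hahnU l r k = 0 := by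
  rw [prod_eq]
  refine Finset.sum_eq_zero fun m hm => ?_
  rw [T_lt l k m hk (by have := Finset.mem_range.mp hm; omega), mul_zero]

lemma orth_self (l k : ℕ) (hk : k ≤ l) :
    ∑ r ∈ Finset.range (l + 1), hahnU l r k * hahnU l r k =
      (((l + k + 1).factorial : ℂ) * ((l - k).factorial : ℂ)) /
          ((2 * (k : ℂ) + 1) * (l.factorial : ℂ) * (l.factorial : ℂ)) := by
  rw [prod_eq, Finset.sum_range_succ, T_self l k hk, Finset.sum_eq_zero]
  · have a1 : ((l.choose k : ℂ)) * k.factorial * (l - k).factorial = l.factorial := by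
      exact_mod_cast Nat.choose_mul_factorial_mul_factorial hk
    have a2 : ((k + k).choose k : ℂ) * k.factorial * k.factorial = ((k + k).factorial : ℂ) := by
      have := Nat.choose_mul_factorial_mul_factorial (Nat.le_add_left k k)
      rw [Nat.add_sub_cancel] at this
      exact_mod_cast this
    have h1 : (l.choose k : ℂ) ≠ 0 := by exact_mod_cast (Nat.choose_pos hk).ne'
    have h1' : ((k + k).choose k : ℂ) ≠ 0 := by
      exact_mod_cast (Nat.choose_pos (Nat.le_add_left k k)).ne'
    have h3 : (k.factorial : ℂ) ≠ 0 := by exact_mod_cast Nat.factorial_ne_zero _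
    have h5 : ((l - k).factorial : ℂ) ≠ 0 := by exact_mod_cast Nat.factorial_ne_zero _
    have h4 : (2 * (k : ℂ) + 1) ≠ 0 := by exact_mod_cast Nat.succ_ne_zero (2 * k)
    have h6 : ((-1 : ℂ) ^ k) * (-1) ^ k = 1 := by
      rw [← mul_pow]; norm_num
    rw [Nat.factorial_succ (2 * k), two_mul k]
    push_cast
    rw [← a1, ← a2, Nat.choose_self, ← two_mul (k : ℂ)]
    generalize ((k + k).choose k : ℂ) = c at *
    generalize ((l + k + 1).factorial : ℂ) = f at *
    rw [zero_add, div_mul_eq_mul_div, mul_comm (_ * _ * _ : ℂ) ((-1) ^ k * _)]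
    field_simp
    try linear_combination f * h6
  · intro n hn
    rw [T_lt l k n hk (Finset.mem_range.mp hn), mul_zero]

/-- Orthogonality of the Hahn polynomial values. -/
theorem hahn_orthogonality (ℓ j k : ℕ) (hj : j ≤ ℓ) (hk : k ≤ ℓ) :
    ∑ r ∈ Finset.range (ℓ + 1), hahnU ℓ r j * hahnU ℓ r k =
      if j = k then
        ((Nat.factorial (ℓ + j + 1) : ℂ) * (Nat.factorial (ℓ - j) : ℂ)) /
          ((2 * (j : ℂ) + 1) * (Nat.factorial ℓ : ℂ) * (Nat.factorial ℓ : ℂ))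
      else 0 := by
  rcases lt_trichotomy j k with h | h | h
  · rw [if_neg h.ne, orth_lt ℓ j k hk h]
  · subst h
    rw [if_pos rfl, orth_self ℓ j hj]
  · rw [if_neg h.ne']
    simp only [mul_comm (hahnU ℓ _ j)]
    exact orth_lt ℓ k j hj h
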